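/- Let G be an S_{3,3}-free simple graph, let u, v be adjacent vertices with d(u) = d(v) = 5, and let b be a neighbor of u with b ≠ v and b not adjacent to v. If d(b) ≥ 4, then b has at least two neighbors that are common neighbors of u and v, i.e. |N(b) ∩ N(u) ∩ N(v)| ≥ 2. -/

import Mathlib

/-- A simple graph `G` contains the double star `S_{m,l}`: there are adjacent vertices
`x, y` and disjoint sets `A ⊆ N(x) \\ {y}`, `B ⊆ N(y) \\ {x}` with `|A| = m`, `|B| = l`
and `x, y ∉ A ∪ B`. -/
def ContainsDoubleStar {V : Type*} (G : SimpleGraph V) (m l : ℕ) : Prop :=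
  ∃ x y : V, ∃ A B : Finset V,
    G.Adj x y ∧
    (∀ a ∈ A, G.Adj x a ∧ a ≠ y) ∧
    (∀ b ∈ B, G.Adj y b ∧ b ≠ x) ∧
    A.card = m ∧ B.card = l ∧ Disjoint A B ∧
    x ∉ A ∧ x ∉ B ∧ y ∉ A ∧ y ∉ B

theorem Finset.exists_disjoint_subsets_card_eq {α : Type*} [DecidableEq α] {P Q : Finset α}
    {m l : ℕ} (hP : m ≤ P.card) (hQ : l ≤ Q.card) (hPQ : m + l ≤ (P ∪ Q).card) :
    ∃ A ⊆ P, ∃ B ⊆ Q, A.card = m ∧ B.card = l ∧ Disjoint A B := by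
  by_cases h : m ≤ (P \ Q).card
  · obtain ⟨A, hA, hAm⟩ := Finset.exists_subset_card_eq h
    obtain ⟨B, hB, hBl⟩ := Finset.exists_subset_card_eq hQ
    exact ⟨A, hA.trans Finset.sdiff_subset, B, hB, hAm, hBl,
      Finset.disjoint_of_subset_left hA
        (Finset.disjoint_of_subset_right hB Finset.sdiff_disjoint)⟩
  · obtain ⟨A, hA, hAP, hAm⟩ :=
      Finset.exists_subsuperset_card_eq (Finset.sdiff_subset : P \ Q ⊆ P) (by omega) hP
    have hsub : P ∪ Q ⊆ A ∪ (Q \ A) := by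
      intro x hx
      have := @hA x
      simp only [Finset.mem_union, Finset.mem_sdiff] at *
      tauto
    have hcard := (Finset.card_le_card hsub).trans (Finset.card_union_le _ _)
    obtain ⟨B, hB, hBl⟩ := Finset.exists_subset_card_eq (show l ≤ (Q \ A).card by omega)
    exact ⟨A, hAP, B, hB.trans Finset.sdiff_subset, hAm, hBl,
      Finset.disjoint_of_subset_right hB Finset.disjoint_sdiff⟩

theorem SimpleGraph.Adj.card_union_lt_of_not_containsDoubleStar {V : Type*} [Fintype V]
    [DecidableEq V] {G : SimpleGraph V} [DecidableRel G.Adj] {m l : ℕ} {x y : V}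
    (hxy : G.Adj x y) (hfree : ¬ ContainsDoubleStar G m l)
    (hx : m < G.degree x) (hy : l < G.degree y) :
    ((G.neighborFinset x).erase y ∪ (G.neighborFinset y).erase x).card < m + l := by
  by_contra! h
  have hcx : ((G.neighborFinset x).erase y).card = G.degree x - 1 := by
    rw [Finset.card_erase_of_mem (by simpa using hxy), G.card_neighborFinset_eq_degree]
  have hcy : ((G.neighborFinset y).erase x).card = G.degree y - 1 := by
    rw [Finset.card_erase_of_mem (by simpa using hxy.symm), G.card_neighborFinset_eq_degree]
  obtain ⟨A, hA, B, hB, hAm, hBl, hAB⟩ :=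
    Finset.exists_disjoint_subsets_card_eq (by omega) (by omega) h
  refine hfree ⟨x, y, A, B, hxy, fun a ha => ?_, fun b hb => ?_, hAm, hBl, hAB,
    fun h => ?_, fun h => ?_, fun h => ?_, fun h => ?_⟩
  · simpa [and_comm] using hA ha
  · simpa [and_comm] using hB hb
  · simpa using hA h
  · simpa using hB h
  · simpa using hA h
  · simpa using hB h

theorem stmt_13 {V : Type*} [Fintype V] [DecidableEq V] (G : SimpleGraph V)
    [DecidableRel G.Adj] (hfree : ¬ ContainsDoubleStar G 3 3) (u v b : V)
    (huv : G.Adj u v) (hu : G.degree u = 5) (hv : G.degree v = 5)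
    (hub : G.Adj u b) (hbv : b ≠ v) (hbv' : ¬ G.Adj b v) (hb : 4 ≤ G.degree b) :
    2 ≤ (G.neighborFinset b ∩ G.neighborFinset u ∩ G.neighborFinset v).card := by
  have huv_lt := huv.card_union_lt_of_not_containsDoubleStar hfree (by omega) (by omega)
  have hub_lt := hub.card_union_lt_of_not_containsDoubleStar hfree (by omega) (by omega)
  have card_erase {x y : V} (h : G.Adj x y) :
      ((G.neighborFinset x).erase y).card = G.degree x - 1 := by
    rw [Finset.card_erase_of_mem (by simpa using h), G.card_neighborFinset_eq_degree]
  have huv_card := Finset.card_union_add_card_inter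
    ((G.neighborFinset u).erase v) ((G.neighborFinset v).erase u)
  have hub_card := Finset.card_union_add_card_inter
    ((G.neighborFinset u).erase b) ((G.neighborFinset b).erase u)
  rw [card_erase huv, card_erase huv.symm] at huv_card
  rw [card_erase hub, card_erase hub.symm] at hub_card
  set C := (G.neighborFinset u).erase v ∩ (G.neighborFinset v).erase u with hC
  have hvC : v ∉ C := by simp [hC]
  have hsub : insert v C ⊆ (G.neighborFinset u).erase b := by
    intro x hx
    simp only [hC, Finset.mem_insert, Finset.mem_inter, Finset.mem_erase,
      SimpleGraph.mem_neighborFinset] at hx ⊢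
    rcases hx with rfl | ⟨⟨-, hux⟩, -, hvx⟩
    · exact ⟨hbv.symm, huv⟩
    · exact ⟨fun h => hbv' (h ▸ hvx.symm), hux⟩
  have heq : insert v C = (G.neighborFinset u).erase b := by
    refine Finset.eq_of_subset_of_card_le hsub ?_
    rw [Finset.card_insert_of_notMem hvC, card_erase hub]
    omega
  refine le_trans (show 2 ≤ _ by omega)
    (Finset.card_le_card (s := (G.neighborFinset u).erase b ∩ (G.neighborFinset b).erase u) ?_)
  intro x hx
  rw [← heq] at hx
  simp only [hC, Finset.mem_insert, Finset.mem_inter, Finset.mem_erase,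
    SimpleGraph.mem_neighborFinset] at hx ⊢
  obtain ⟨rfl | ⟨⟨-, hux⟩, -, hvx⟩, -, hbx⟩ := hx
  · exact absurd hbx hbv'
  · exact ⟨⟨hbx, hux⟩, hvx⟩
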